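/- arXiv:2512.10858 — 5 statements merged into one kernel-verified Lean document; each statement's English description precedes it below -/
import Mathlib

section
/- Let λ : [0,1] → ℝ be continuously differentiable and strictly decreasing with λ(0) = λ_max and λ(1) = λ_min, let ι be a finite type (the vocabulary), let π : ℝ → (ι → ℝ) be continuously differentiable, and fix x, z ∈ ι. For μ ∈ ℝ and a vector v : ι → ℝ define q_μ(v) = σ(μ)·v + σ(−μ)·π(μ) coordinatewise, and write q_μ(x) := q_μ(e_x). Let x̂ : ℝ → (ι → ℝ) be continuous (the model's predicted distribution as a function of the log-SNR), and assume q_μ(x)_i > 0 and q_μ(x̂(μ))_i > 0 for all i ∈ ι and all μ in the closed interval [λ_min, λ_max]. Define E(μ) = D_KL(q_μ(x) ‖ q_μ(x̂(μ))) + D_IS(q_μ(x)_z ‖ q_μ(x̂(μ))_z), and for t ∈ [0,1] define the weight w(t) = (1/q_{λ(t)}(x)_z)·[ (1 − σ(λ(t)))·(d/dt)(π ∘ λ)(t)_z − ((d/dt)σ(λ(t)) / σ(λ(t)))·π(λ(t))_z ]. Then ∫₀¹ w(t)·E(λ(t)) dt = ∫_{λ_min}^{λ_max} [ σ(−μ)·(π(μ)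 − π'(μ))_z / q_μ(x)_z ]·E(μ) dμ. -/
/-- The logistic sigmoid function. -/
noncomputable def sigmoid (x : ℝ) : ℝ := 1 / (1 + Real.exp (-x))

/-- The one-hot vector of `x`. -/
def oneHot {ι : Type*} [DecidableEq ι] (x : ι) : ι → ℝ :=
  fun i => if i = x then 1 else 0

/-- Kullback–Leibler divergence between finite probability vectors. -/
noncomputable def klDiv {ι : Type*} [Fintype ι] (p q : ι → ℝ) : ℝ :=
  ∑ i, p i * Real.log (p i / q i)

/-- Pointwise Itakura–Saito divergence. -/
noncomputable def isDiv (p q : ℝ) : ℝ := p / q - Real.log (p / q) - 1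

theorem one_sub_sigmoid (x : ℝ) : 1 - sigmoid x = sigmoid (-x) := by
  have h := Real.exp_pos x
  simp only [sigmoid, neg_neg, Real.exp_neg]
  field_simp
  ring

theorem sigmoid_pos (x : ℝ) : 0 < sigmoid x := by
  unfold sigmoid
  positivity

theorem hasDerivAt_sigmoid (x : ℝ) :
    HasDerivAt sigmoid (sigmoid x * sigmoid (-x)) x := by
  have hden : 1 + Real.exp (-x) ≠ 0 := by positivity
  have h := (((hasDerivAt_neg x).exp).const_add 1).fun_inv hden
  have hfun : sigmoid = fun y => (1 + Real.exp (-y))⁻¹ := by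
    funext y
    exact one_div _
  rw [← one_sub_sigmoid, hfun]
  refine h.congr_deriv ?_
  field_simp
  ring

/-- Substitution `u = f t` along an antitone function, with no regularity required of `g`. -/
theorem integral_comp_mul_neg_deriv_of_antitoneOn {f g : ℝ → ℝ} {a b : ℝ} (hab : a ≤ b)
    (hf : Differentiable ℝ f) (hanti : AntitoneOn f (Set.Icc a b)) :
    ∫ t in a..b, g (f t) * -deriv f t = ∫ u in f b..f a, g u := by
  have h := intervalIntegral.integral_comp_mul_deriv_of_deriv_nonpos (a := a) (b := b)
    (f' := deriv f) (g := g) hf.continuous.continuousOn (fun t _ => (hf t).hasDerivAt)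
    (fun t ht => by
      rw [min_eq_left hab, max_eq_right hab] at ht
      rw [← derivWithin_of_mem_nhds (Icc_mem_nhds ht.1 ht.2)]
      exact hanti.derivWithin_nonpos)
  rw [intervalIntegral.integral_symm (f a), ← h, ← intervalIntegral.integral_neg]
  simp only [Function.comp_apply, mul_neg]

/-- Proposition 1 (reparameterization of the GIDD ELBO from time to log-SNR):
the time-weighted ELBO integral equals the log-SNR integral with weight
`σ(−μ)·(π(μ) − π'(μ))_z / q_μ(x)_z`. -/
theorem gidd_elbo_logsnr_reparam
    {ι : Type*} [Fintype ι] [DecidableEq ι]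
    (l : ℝ → ℝ) (lmin lmax : ℝ)
    (hl : ContDiff ℝ 1 l)
    (hlanti : StrictAntiOn l (Set.Icc 0 1))
    (hl0 : l 0 = lmax) (hl1 : l 1 = lmin)
    (π : ℝ → ι → ℝ) (hπ : ContDiff ℝ 1 π)
    (x z : ι)
    (xhat : ℝ → ι → ℝ) (hxhat : Continuous xhat)
    (q : ℝ → (ι → ℝ) → ι → ℝ)
    (hq : ∀ μ v, q μ v = fun i => sigmoid μ * v i + sigmoid (-μ) * π μ i)
    (hpos1 : ∀ μ ∈ Set.Icc lmin lmax, ∀ i, 0 < q μ (oneHot x) i)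
    (hpos2 : ∀ μ ∈ Set.Icc lmin lmax, ∀ i, 0 < q μ (xhat μ) i)
    (E : ℝ → ℝ)
    (hE : ∀ μ, E μ = klDiv (q μ (oneHot x)) (q μ (xhat μ))
        + isDiv (q μ (oneHot x) z) (q μ (xhat μ) z))
    (w : ℝ → ℝ)
    (hw : ∀ t, w t = (1 / q (l t) (oneHot x) z) *
        ((1 - sigmoid (l t)) * deriv (fun s => π (l s) z) t
          - (deriv (fun s => sigmoid (l s)) t / sigmoid (l t)) * π (l t) z)) :
    ∫ t in (0:ℝ)..1, w t * E (l t)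
      = ∫ μ in lmin..lmax,
          (sigmoid (-μ) * (π μ z - deriv (fun ν => π ν z) μ) / q μ (oneHot x) z) * E μ := by
  have hld : Differentiable ℝ l := hl.differentiable one_ne_zero
  have hπd : Differentiable ℝ fun ν => π ν z :=
    differentiable_pi.mp (hπ.differentiable one_ne_zero) z
  rw [← hl0, ← hl1, ← integral_comp_mul_neg_deriv_of_antitoneOn zero_le_one hld hlanti.antitoneOn]
  congr 1
  funext t
  have h1 : deriv (fun s => π (l s) z) t = deriv (fun ν => π ν z) (l t) * deriv l t :=
    ((hπd (l t)).hasDerivAt.comp t (hld t).hasDerivAt).deriv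
  have h2 : deriv (fun s => sigmoid (l s)) t = sigmoid (l t) * sigmoid (-l t) * deriv l t :=
    ((hasDerivAt_sigmoid (l t)).comp t (hld t).hasDerivAt).deriv
  have hs := (sigmoid_pos (l t)).ne'
  rw [hw, h1, h2, one_sub_sigmoid, mul_assoc (sigmoid (l t)), mul_div_cancel_left₀ _ hs]
  ring
end

section
/- Let ι be a finite type, let λ : ℝ → ℝ be differentiable at t ∈ ℝ, and let π : ℝ → (ι → ℝ) be differentiable at λ(t). Set α(t) = σ(λ(t)) and β(t) = 1 − α(t), where σ is the logistic sigmoid. Then for every coordinate i ∈ ι, β(t)·(d/dt)(π ∘ λ)(t)_i − (α'(t)/α(t))·π(λ(t))_i = σ(−λ(t))·λ'(t)·( π'(λ(t)) − π(λ(t)) )_i, where α'(t) = (d/dt)σ(λ(t)) and π'(λ(t)) is the derivative of π evaluated at λ(t). -/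
theorem sigmoid_eq_real_sigmoid : sigmoid = Real.sigmoid := by
  funext x
  rw [sigmoid, Real.sigmoid_def, one_div]

/-- Pointwise rewriting of the GIDD ELBO weighting term
`β_t·π_t' − (α_t'/α_t)·π_t` purely in terms of the log-SNR `λ`. -/
theorem gidd_weight_logsnr_identity
    {ι : Type*} [Fintype ι]
    (l : ℝ → ℝ) (t : ℝ) (hl : DifferentiableAt ℝ l t)
    (π : ℝ → ι → ℝ) (hπ : DifferentiableAt ℝ π (l t))
    (i : ι) :
    (1 - sigmoid (l t)) * deriv (fun s => π (l s) i) t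
        - (deriv (fun s => sigmoid (l s)) t / sigmoid (l t)) * π (l t) i
      = sigmoid (-(l t)) * deriv l t * (deriv (fun μ => π μ i) (l t) - π (l t) i) := by
  have hσ : HasDerivAt (fun s => Real.sigmoid (l s))
      (Real.sigmoid (l t) * (1 - Real.sigmoid (l t)) * deriv l t) t :=
    (Real.hasDerivAt_sigmoid (l t)).comp t hl.hasDerivAt
  have hπl : HasDerivAt (fun s => π (l s) i) (deriv (fun μ => π μ i) (l t) * deriv l t) t :=
    (differentiableAt_pi.mp hπ i).hasDerivAt.comp t hl.hasDerivAt
  have hpos := Real.sigmoid_pos (l t)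
  rw [sigmoid_eq_real_sigmoid, hσ.deriv, hπl.deriv, Real.sigmoid_neg]
  field_simp
end

section
/- Let ι be a finite type, x ∈ ι, and let α_s, α_t, β_s, β_t ∈ ℝ with β_s = 1 − α_s, β_t = 1 − α_t and α_s ≠ 0. Let π_s, π_t : ι → ℝ with Σ_{i ∈ ι} π_s(i) = 1. Define the marginal vectors q_s(x) = α_s·e_x + β_s·π_s and q_t(x) = α_t·e_x + β_t·π_t, the transition coefficient α_{t|s} = α_t / α_s, and the vector v = β_t·π_t − α_{t|s}·β_s·π_s. Then for every z_t ∈ ι, Σ_{z_s ∈ ι} ( α_{t|s}·(e_{z_s})_{z_t} + v_{z_t} )·q_s(x)_{z_s} = q_t(x)_{z_t}; that is, applying the one-step transition q_{t|s}(·|z_s) = α_{t|s}·e_{z_s} + v to the marginal at time s yields the marginal at time t. -/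
theorem sum_oneHot_mul {ι : Type*} [Fintype ι] [DecidableEq ι] (j : ι) (f : ι → ℝ) :
    ∑ i, oneHot i j * f i = f j := by
  simp [oneHot]

theorem sum_oneHot {ι : Type*} [Fintype ι] [DecidableEq ι] (x : ι) :
    ∑ i, oneHot x i = 1 := by
  simp [oneHot]

/-- Chapman–Kolmogorov consistency of the GIDD forward process: applying the
one-step transition `q_{t|s}(·|z_s) = α_{t|s}·e_{z_s} + v` to the marginal at
time `s` yields the marginal at time `t`. -/
theorem gidd_chapman_kolmogorov
    {ι : Type*} [Fintype ι] [DecidableEq ι]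
    (x : ι) (αs αt βs βt : ℝ)
    (hβs : βs = 1 - αs) (hβt : βt = 1 - αt) (hαs : αs ≠ 0)
    (πs πt : ι → ℝ) (hπs : ∑ i, πs i = 1)
    (zt : ι) :
    ∑ zs, ((αt / αs) * oneHot zs zt + (βt * πt zt - (αt / αs) * βs * πs zt)) *
        (αs * oneHot x zs + βs * πs zs)
      = αt * oneHot x zt + βt * πt zt := by
  have marginal_sum : ∑ zs, (αs * oneHot x zs + βs * πs zs) = 1 := by
    rw [Finset.sum_add_distrib, ← Finset.mul_sum, ← Finset.mul_sum, sum_oneHot, hπs, hβs]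
    ring
  simp only [add_mul _ _ (αs * oneHot x _ + βs * πs _), mul_assoc (αt / αs) (oneHot _ zt)]
  rw [Finset.sum_add_distrib, ← Finset.mul_sum, ← Finset.mul_sum, marginal_sum,
    sum_oneHot_mul zt fun zs => αs * oneHot x zs + βs * πs zs]
  field_simp
  ring
end

section
/- Let α > 0, B_min > 0, and S_min > 0 be real numbers. Consider pairs (B, S) of reals with B > B_min and S > S_min satisfying the iso-loss constraint ((S/S_min)^α − 1)·((B/B_min)^α − 1) = 1. Then: (i) the pair B* = 2^{1/α}·B_min, S* = 2^{1/α}·S_min satisfies the constraint; (ii) every pair (B, S) satisfying the constraint has B·S ≥ 4^{1/α}·B_min·S_min, with equality if and only if B = B* and S = S*. Consequently the minimum total token count D = B·S over the constraint curve is D* = 4^{1/α}·B_min·S_min, attained uniquely at (B*, S*). -/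
theorem four_le_mul_of_sub_one_mul_sub_one {u v : ℝ} (hu : 1 < u)
    (h : (u - 1) * (v - 1) = 1) : 4 ≤ u * v := by
  nlinarith [sq_nonneg (u - 2), mul_pos (sub_pos.2 hu) (sub_pos.2 hu),
    sq_nonneg (u - v), sq_nonneg (u + v - 4)]

theorem eq_two_of_mul_eq_four {u v : ℝ} (h : (u - 1) * (v - 1) = 1) (huv : u * v = 4) :
    u = 2 ∧ v = 2 := by
  have hsum : u + v = 4 := by linarith
  have hv : v = 4 - u := by linarith
  subst hv
  have hu : u = 2 := by nlinarith [sq_nonneg (u - 2)]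
  exact ⟨hu, by linarith⟩

/-- The iso-loss problem in the normalized variables `x = S / S_min`, `y = B / B_min`. -/
theorem normalized_iso_loss {α x y : ℝ} (hα : 0 < α) (hx : 1 < x) (hy : 1 < y)
    (h : (x ^ α - 1) * (y ^ α - 1) = 1) :
    (4 : ℝ) ^ (1 / α) ≤ x * y ∧
      (x * y = (4 : ℝ) ^ (1 / α) → x = 2 ^ (1 / α) ∧ y = 2 ^ (1 / α)) := by
  have hx0 : 0 ≤ x := by linarith
  have hy0 : 0 ≤ y := by linarith
  have hroot {z : ℝ} (hz : 0 ≤ z) : (z ^ α) ^ (1 / α) = z := by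
    rw [one_div, Real.rpow_rpow_inv hz hα.ne']
  have hmul : (x * y) ^ α = x ^ α * y ^ α := Real.mul_rpow hx0 hy0
  constructor
  · rw [← hroot (mul_nonneg hx0 hy0), hmul]
    exact Real.rpow_le_rpow (by norm_num)
      (four_le_mul_of_sub_one_mul_sub_one (Real.one_lt_rpow hx hα) h) (by positivity)
  · intro he
    rw [he, one_div, Real.rpow_inv_rpow (by norm_num) hα.ne'] at hmul
    obtain ⟨hu, hv⟩ := eq_two_of_mul_eq_four h hmul.symm
    exact ⟨by rw [← hu, hroot hx0], by rw [← hv, hroot hy0]⟩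

/-- Token-optimal batch size and step count on the iso-loss hyperbola
`((S/S_min)^α − 1)·((B/B_min)^α − 1) = 1`: the pair
`(B*, S*) = (2^{1/α}·B_min, 2^{1/α}·S_min)` satisfies the constraint, and it
uniquely minimizes the total token count `D = B·S`, with minimum value
`D* = 4^{1/α}·B_min·S_min`. -/
theorem iso_loss_token_optimal_batch
    (α Bmin Smin : ℝ) (hα : 0 < α) (hB : 0 < Bmin) (hS : 0 < Smin) :
    (((2 ^ (1 / α) * Smin / Smin) ^ α - 1) *
        ((2 ^ (1 / α) * Bmin / Bmin) ^ α - 1) = 1) ∧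
    (∀ B S : ℝ, Bmin < B → Smin < S →
      ((S / Smin) ^ α - 1) * ((B / Bmin) ^ α - 1) = 1 →
      (4 : ℝ) ^ (1 / α) * (Bmin * Smin) ≤ B * S ∧
        (B * S = (4 : ℝ) ^ (1 / α) * (Bmin * Smin) ↔
          B = 2 ^ (1 / α) * Bmin ∧ S = 2 ^ (1 / α) * Smin)) := by
  have htwo : ((2 : ℝ) ^ (1 / α)) ^ α = 2 := by
    rw [one_div, Real.rpow_inv_rpow (by norm_num) hα.ne']
  have hfour : (4 : ℝ) ^ (1 / α) = 2 ^ (1 / α) * 2 ^ (1 / α) := by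
    rw [← Real.mul_rpow (by norm_num) (by norm_num)]
    norm_num
  refine ⟨?_, fun B S hBB hSS h => ?_⟩
  · rw [mul_div_cancel_right₀ _ hS.ne', mul_div_cancel_right₀ _ hB.ne', htwo]
    norm_num
  · obtain ⟨hle, heq⟩ := normalized_iso_loss hα ((one_lt_div hS).2 hSS) ((one_lt_div hB).2 hBB) h
    have hprod : S / Smin * (B / Bmin) = B * S / (Bmin * Smin) := by
      rw [div_mul_div_comm, mul_comm S, mul_comm Smin]
    have hpos : 0 < Bmin * Smin := mul_pos hB hS
    rw [hprod] at hle heq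
    refine ⟨(le_div_iff₀ hpos).1 hle, fun he => ?_, ?_⟩
    · obtain ⟨hs, hb⟩ := heq ((div_eq_iff hpos.ne').2 he)
      exact ⟨(div_eq_iff hB.ne').1 hb, (div_eq_iff hS.ne').1 hs⟩
    · rintro ⟨rfl, rfl⟩
      rw [hfour]
      ring
end

section
/- Let ι be a finite type, x, z ∈ ι, and let π : ℝ → (ι → ℝ) be continuously differentiable. For μ ∈ ℝ and v : ι → ℝ define q_μ(v) = σ(μ)·v + σ(−μ)·π(μ), and write q_μ(x) := q_μ(e_x). Let x̂ : ℝ → (ι → ℝ) be continuous, fix λ_min < λ_max, and assume q_μ(x)_i > 0 and q_μ(x̂(μ))_i > 0 for all i ∈ ι and all μ ∈ [λ_min, λ_max]. Define E(μ) = D_KL(q_μ(x) ‖ q_μ(x̂(μ))) + D_IS(q_μ(x)_z ‖ q_μ(x̂(μ))_z). Let λ₁, λ₂ : [0,1] → ℝ be two continuously differentiable, strictly decreasing noise schedules with λ₁(0) = λ₂(0) = λ_max and λ₁(1) = λ₂(1) = λ_min, and for each schedule λ ∈ {λ₁, λ₂} define the weight w^{λ}(t) = (1/q_{λ(t)}(x)_z)·[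 (1 − σ(λ(t)))·(d/dt)(π ∘ λ)(t)_z − ((d/dt)σ(λ(t)) / σ(λ(t)))·π(λ(t))_z ]. Then ∫₀¹ w^{λ₁}(t)·E(λ₁(t)) dt = ∫₀¹ w^{λ₂}(t)·E(λ₂(t)) dt; that is, the weighted ELBO integral is invariant to the choice of noise schedule. -/
theorem logistic_pos (μ : ℝ) : 0 < sigmoid μ := by
  unfold sigmoid
  positivity

theorem contDiff_logistic {n : WithTop ℕ∞} : ContDiff ℝ n sigmoid := by
  unfold sigmoid
  exact contDiff_const.div (contDiff_const.add contDiff_neg.exp)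
    fun μ => (by positivity : (0 : ℝ) < 1 + Real.exp (-μ)).ne'

theorem ContinuousOn.klDiv {α ι : Type*} [TopologicalSpace α] [Fintype ι]
    {p q : α → ι → ℝ} {s : Set α} (hp : ContinuousOn p s) (hq : ContinuousOn q s)
    (hp0 : ∀ a ∈ s, ∀ i, 0 < p a i) (hq0 : ∀ a ∈ s, ∀ i, 0 < q a i) :
    ContinuousOn (fun a => klDiv (p a) (q a)) s := by
  unfold _root_.klDiv
  refine continuousOn_finsetSum _ fun i _ => ?_
  have hpi := continuousOn_pi.1 hp i
  have hqi := continuousOn_pi.1 hq i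
  exact hpi.mul ((hpi.div hqi fun a ha => (hq0 a ha i).ne').log
    fun a ha => (div_pos (hp0 a ha i) (hq0 a ha i)).ne')

theorem ContinuousOn.isDiv {α : Type*} [TopologicalSpace α] {p q : α → ℝ} {s : Set α}
    (hp : ContinuousOn p s) (hq : ContinuousOn q s)
    (hp0 : ∀ a ∈ s, 0 < p a) (hq0 : ∀ a ∈ s, 0 < q a) :
    ContinuousOn (fun a => isDiv (p a) (q a)) s := by
  have h := hp.div hq fun a ha => (hq0 a ha).ne'
  exact (h.sub (h.log fun a ha => (div_pos (hp0 a ha) (hq0 a ha)).ne')).sub continuousOn_const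

/-- The ELBO weight per unit of log-SNR, for the `z`-coordinate `p` of the mixing distribution
and the `z`-marginal `Q`. -/
noncomputable def logSNRWeight (p Q : ℝ → ℝ) (μ : ℝ) : ℝ :=
  (1 / Q μ) * ((1 - sigmoid μ) * deriv p μ - (deriv sigmoid μ / sigmoid μ) * p μ)

theorem continuousOn_logSNRWeight {p Q : ℝ → ℝ} {s : Set ℝ} (hp : ContDiff ℝ 1 p)
    (hQ : ContinuousOn Q s) (hQ0 : ∀ μ ∈ s, Q μ ≠ 0) :
    ContinuousOn (logSNRWeight p Q) s := by
  have hσ : Continuous sigmoid := (contDiff_logistic (n := 0)).continuous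
  have hσd : Continuous (deriv sigmoid) := contDiff_logistic.continuous_deriv le_rfl
  have hpd : Continuous (deriv p) := hp.continuous_deriv le_rfl
  exact (continuousOn_const.div hQ hQ0).mul
    (((continuous_const.sub hσ).mul hpd).sub
      ((hσd.div hσ fun μ => (logistic_pos μ).ne').mul hp.continuous)).continuousOn

/-- Integrating the time-dependent ELBO weight along a schedule amounts to integrating
`logSNRWeight` over the log-SNR range of the schedule. -/
theorem integral_schedule_eq_integral_logSNR {p Q E l w : ℝ → ℝ} {a b : ℝ}
    (hp : ContDiff ℝ 1 p) (hl : ContDiff ℝ 1 l)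
    (hcont : ContinuousOn (fun μ => logSNRWeight p Q μ * E μ) (l '' Set.uIcc a b))
    (hw : ∀ t, w t = (1 / Q (l t)) * ((1 - sigmoid (l t)) * deriv (fun s => p (l s)) t
      - (deriv (fun s => sigmoid (l s)) t / sigmoid (l t)) * p (l t))) :
    ∫ t in a..b, w t * E (l t) = ∫ μ in l a..l b, logSNRWeight p Q μ * E μ := by
  have hld : Differentiable ℝ l := hl.differentiable one_ne_zero
  rw [← intervalIntegral.integral_comp_mul_deriv' (f := l) (f' := deriv l)
    (fun t _ => (hld t).hasDerivAt) (hl.continuous_deriv le_rfl).continuousOn hcont]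
  refine intervalIntegral.integral_congr fun t _ => ?_
  have h₁ : deriv (fun s => p (l s)) t = deriv p (l t) * deriv l t :=
    deriv_comp t (hp.differentiable one_ne_zero _) (hld t)
  have h₂ : deriv (fun s => sigmoid (l s)) t = deriv sigmoid (l t) * deriv l t :=
    deriv_comp t ((contDiff_logistic (n := 1)).differentiable one_ne_zero _) (hld t)
  simp only [hw, h₁, h₂, Function.comp_apply, logSNRWeight]
  ring

theorem StrictAntiOn.image_uIcc_subset_Icc {l : ℝ → ℝ} {a b : ℝ} (hab : a ≤ b)
    (hl : StrictAntiOn l (Set.Icc a b)) : l '' Set.uIcc a b ⊆ Set.Icc (l b) (l a) := by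
  rw [Set.uIcc_of_le hab]
  exact hl.antitoneOn.mapsTo_Icc.image_subset

/-- Noise-schedule invariance of the GIDD ELBO: for any two continuously
differentiable, strictly decreasing noise schedules with the same log-SNR
endpoints, the weighted ELBO integrals agree. -/
theorem gidd_elbo_schedule_invariance
    {ι : Type*} [Fintype ι] [DecidableEq ι]
    (π : ℝ → ι → ℝ) (hπ : ContDiff ℝ 1 π)
    (x z : ι)
    (xhat : ℝ → ι → ℝ) (hxhat : Continuous xhat)
    (lmin lmax : ℝ) (hlt : lmin < lmax)
    (q : ℝ → (ι → ℝ) → ι → ℝ)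
    (hq : ∀ μ v, q μ v = fun i => sigmoid μ * v i + sigmoid (-μ) * π μ i)
    (hpos1 : ∀ μ ∈ Set.Icc lmin lmax, ∀ i, 0 < q μ (oneHot x) i)
    (hpos2 : ∀ μ ∈ Set.Icc lmin lmax, ∀ i, 0 < q μ (xhat μ) i)
    (E : ℝ → ℝ)
    (hE : ∀ μ, E μ = klDiv (q μ (oneHot x)) (q μ (xhat μ))
        + isDiv (q μ (oneHot x) z) (q μ (xhat μ) z))
    (l₁ l₂ : ℝ → ℝ)
    (hl₁ : ContDiff ℝ 1 l₁) (hl₂ : ContDiff ℝ 1 l₂)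
    (hl₁anti : StrictAntiOn l₁ (Set.Icc 0 1)) (hl₂anti : StrictAntiOn l₂ (Set.Icc 0 1))
    (hl₁0 : l₁ 0 = lmax) (hl₁1 : l₁ 1 = lmin)
    (hl₂0 : l₂ 0 = lmax) (hl₂1 : l₂ 1 = lmin)
    (w₁ w₂ : ℝ → ℝ)
    (hw₁ : ∀ t, w₁ t = (1 / q (l₁ t) (oneHot x) z) *
        ((1 - sigmoid (l₁ t)) * deriv (fun s => π (l₁ s) z) t
          - (deriv (fun s => sigmoid (l₁ s)) t / sigmoid (l₁ t)) * π (l₁ t) z))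
    (hw₂ : ∀ t, w₂ t = (1 / q (l₂ t) (oneHot x) z) *
        ((1 - sigmoid (l₂ t)) * deriv (fun s => π (l₂ s) z) t
          - (deriv (fun s => sigmoid (l₂ s)) t / sigmoid (l₂ t)) * π (l₂ t) z)) :
    ∫ t in (0:ℝ)..1, w₁ t * E (l₁ t) = ∫ t in (0:ℝ)..1, w₂ t * E (l₂ t) := by
  have hσ : Continuous sigmoid := (contDiff_logistic (n := 0)).continuous
  have hπz : ContDiff ℝ 1 (fun μ => π μ z) := contDiff_pi.1 hπ z
  have hqc : ∀ v : ℝ → ι → ℝ, Continuous v → Continuous fun μ => q μ (v μ) := by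
    intro v hv
    simp only [hq]
    exact continuous_pi fun i => (hσ.mul (continuous_pi_iff.1 hv i)).add
      ((hσ.comp continuous_neg).mul (continuous_pi_iff.1 hπ.continuous i))
  have hp := hqc (fun _ => oneHot x) continuous_const
  have hp' := hqc xhat hxhat
  have hpz : Continuous fun μ => q μ (oneHot x) z := continuous_pi_iff.1 hp z
  have hEc : ContinuousOn E (Set.Icc lmin lmax) := by
    rw [funext hE]
    exact (hp.continuousOn.klDiv hp'.continuousOn hpos1 hpos2).add
      (hpz.continuousOn.isDiv (continuous_pi_iff.1 hp' z).continuousOn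
        (fun μ hμ => hpos1 μ hμ z) (fun μ hμ => hpos2 μ hμ z))
  have hg : ContinuousOn
      (fun μ => logSNRWeight (fun μ => π μ z) (fun μ => q μ (oneHot x) z) μ * E μ)
      (Set.Icc lmin lmax) :=
    (continuousOn_logSNRWeight hπz hpz.continuousOn fun μ hμ => (hpos1 μ hμ z).ne').mul hEc
  have hs₁ := hl₁anti.image_uIcc_subset_Icc zero_le_one
  have hs₂ := hl₂anti.image_uIcc_subset_Icc zero_le_one
  rw [hl₁0, hl₁1] at hs₁
  rw [hl₂0, hl₂1] at hs₂
  rw [integral_schedule_eq_integral_logSNR hπz hl₁ (hg.mono hs₁) hw₁,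
    integral_schedule_eq_integral_logSNR hπz hl₂ (hg.mono hs₂) hw₂, hl₁0, hl₁1, hl₂0, hl₂1]
end
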